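/- Let N ≥ 2, let ρ be a density matrix on ℂ^N, and let O be an N×N complex Hermitian matrix with operator norm ‖O‖_∞ ≤ 1. Then the variance of the expectation value tr(O U ρ U†) over a Haar-random unitary U is at most 1/(N+1), i.e., ∫_{U(N)} (tr(O U ρ U†))² dμ_H(U) − (∫_{U(N)} tr(O U ρ U†) dμ_H(U))² ≤ 1/(N+1). -/

import Mathlib

open MeasureTheory Matrix
open scoped ComplexOrder

attribute [local instance] Matrix.frobeniusNormedAddCommGroup Matrix.frobeniusNormedSpace

/-- The Borel measurable-space structure on matrices (the product σ-algebra). -/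
instance matrixMeasurableSpace {m n α : Type*} [MeasurableSpace α] :
    MeasurableSpace (Matrix m n α) :=
  inferInstanceAs (MeasurableSpace (m → n → α))

noncomputable section

open Complex in
/-- The unitary `1 - (1 - i) / 2 • v v†` with `v = e_i + ω e_k`, where `|ω| = 1` and `i ≠ k`. It
multiplies `v` by the imaginary unit and fixes the orthogonal complement of `v`. -/
def planePhase {n : Type*} [DecidableEq n] (i k : n) (ω : ℂ) : Matrix n n ℂ :=
  1 - ((1 - I) / 2) • vecMulVec (Pi.single i 1 + Pi.single k ω)
    (star (Pi.single i 1 + Pi.single k ω))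

section Haar

variable {n : Type*} [Fintype n] [DecidableEq n]

open Complex

theorem planePhase_mem_unitaryGroup {i k : n} (hik : i ≠ k) {ω : ℂ} (hω : star ω * ω = 1) :
    planePhase i k ω ∈ unitaryGroup n ℂ := by
  rw [mem_unitaryGroup_iff]
  set v : n → ℂ := Pi.single i 1 + Pi.single k ω with hv
  have hvv : star v ⬝ᵥ v = 2 := by
    simp only [hv, star_add, add_dotProduct, dotProduct_add, Pi.star_single]
    simp [hik, hik.symm]
    have : (starRingEnd ℂ) ω * ω = 1 := hω
    rw [this]; norm_num
  have hP : vecMulVec v (star v) * vecMulVec v (star v) = (2 : ℂ) • vecMulVec v (star v) := by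
    rw [vecMulVec_mul_vecMulVec, hvv]
    ext a b; simp [vecMulVec_apply]; ring
  have hS : star (vecMulVec v (star v)) = vecMulVec v (star v) := by
    rw [star_eq_conjTranspose, conjTranspose_vecMulVec, star_star]
  have hc : star ((1 - I) / 2) = (1 + I) / 2 := by simp
  rw [planePhase, ← hv, star_sub, star_smul, hS, star_one, hc, sub_mul, mul_sub, mul_sub,
    smul_mul_smul_comm, hP, smul_smul, one_mul, mul_one, one_mul]
  have h2 : (1 - I) / 2 * ((1 + I) / 2) * 2 = (1 - I) / 2 + (1 + I) / 2 := by
    linear_combination (-1 / 2 : ℂ) * I_sq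
  rw [h2, add_smul]
  abel

theorem planePhase_mul_apply {i k : n} (hik : i ≠ k) (ω : ℂ) (A : Matrix n n ℂ) (j : n) :
    (planePhase i k ω * A) i j = A i j - (1 - I) / 2 * (A i j + star ω * A k j) := by
  rw [planePhase, sub_mul, one_mul, smul_mul_assoc, vecMulVec_mul, Matrix.sub_apply,
    Matrix.smul_apply, vecMulVec_apply, star_add, Pi.star_single, Pi.star_single, add_vecMul]
  simp [hik]

theorem measurable_unitaryGroup_entry (i j : n) :
    Measurable fun U : unitaryGroup n ℂ => (U : Matrix n n ℂ) i j :=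
  (measurable_pi_apply j).comp ((measurable_pi_apply i).comp measurable_subtype_coe)

theorem measurable_unitaryGroup_of_entry {α : Type*} [MeasurableSpace α] {f : α → unitaryGroup n ℂ}
    (hf : ∀ i j, Measurable fun x => (f x : Matrix n n ℂ) i j) : Measurable f :=
  Measurable.subtype_mk (h := fun x => (f x).2)
    (measurable_pi_lambda _ fun i => measurable_pi_lambda _ fun j => hf i j)

instance unitaryGroup_measurableMul : MeasurableMul (unitaryGroup n ℂ) where
  measurable_const_mul V := measurable_unitaryGroup_of_entry fun i j => by
    simp only [UnitaryGroup.mul_val, Matrix.mul_apply]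
    exact Finset.measurable_sum _ fun k _ => (measurable_unitaryGroup_entry k j).const_mul _
  measurable_mul_const V := measurable_unitaryGroup_of_entry fun i j => by
    simp only [UnitaryGroup.mul_val, Matrix.mul_apply]
    exact Finset.measurable_sum _ fun k _ => (measurable_unitaryGroup_entry i k).mul_const _

theorem measurable_normSq_entry (i j : n) :
    Measurable fun U : unitaryGroup n ℂ => normSq ((U : Matrix n n ℂ) i j) :=
  continuous_normSq.measurable.comp (measurable_unitaryGroup_entry i j)

theorem normSq_entry_le_one (U : unitaryGroup n ℂ) (i j : n) :
    normSq ((U : Matrix n n ℂ) i j) ≤ 1 := by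
  rw [normSq_eq_norm_sq]
  exact pow_le_one₀ (norm_nonneg _) (entry_norm_bound_of_unitary U.2 i j)

theorem sum_normSq_col (U : unitaryGroup n ℂ) (j : n) :
    ∑ i, normSq ((U : Matrix n n ℂ) i j) = 1 := by
  have h := congrFun (congrFun (mem_unitaryGroup_iff'.1 U.2) j) j
  rw [Matrix.mul_apply, Matrix.one_apply_eq] at h
  have hcast : ((∑ i, normSq ((U : Matrix n n ℂ) i j) : ℝ) : ℂ) = 1 := by
    rw [← h]
    push_cast
    exact Finset.sum_congr rfl fun i _ => by
      rw [normSq_eq_conj_mul_self, star_apply]; rfl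
  exact_mod_cast hcast

theorem sum_mul_normSq_sq (d : n → ℝ) (j : n) (U : unitaryGroup n ℂ) :
    (∑ i, d i * normSq ((U : Matrix n n ℂ) i j)) ^ 2
      = ∑ i, ∑ k, d i * d k *
          (normSq ((U : Matrix n n ℂ) i j) * normSq ((U : Matrix n n ℂ) k j)) := by
  rw [sq, Finset.sum_mul_sum]
  exact Finset.sum_congr rfl fun i _ => Finset.sum_congr rfl fun k _ => by ring

variable (μ : Measure (unitaryGroup n ℂ)) [IsProbabilityMeasure μ]

theorem integrable_normSq_entry (i j : n) :
    Integrable (fun U : unitaryGroup n ℂ => normSq ((U : Matrix n n ℂ) i j)) μ :=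
  Integrable.of_bound (measurable_normSq_entry i j).aestronglyMeasurable 1 <|
    Filter.Eventually.of_forall fun U => by
      rw [Real.norm_of_nonneg (normSq_nonneg _)]
      exact normSq_entry_le_one U i j

theorem integrable_normSq_entry_mul (i k j l : n) :
    Integrable (fun U : unitaryGroup n ℂ =>
      normSq ((U : Matrix n n ℂ) i j) * normSq ((U : Matrix n n ℂ) k l)) μ :=
  Integrable.of_bound
    ((measurable_normSq_entry i j).mul (measurable_normSq_entry k l)).aestronglyMeasurable 1 <|
    Filter.Eventually.of_forall fun U => by
      rw [Real.norm_of_nonneg (mul_nonneg (normSq_nonneg _) (normSq_nonneg _))]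
      exact mul_le_one₀ (normSq_entry_le_one U i j) (normSq_nonneg _) (normSq_entry_le_one U k l)

/-- Averaging the squared modulus squared over four phases of a balanced superposition. -/
theorem normSq_phase_average (a b : ℂ) :
    normSq (a - (1 - I) / 2 * (a + star 1 * b)) ^ 2
      + normSq (a - (1 - I) / 2 * (a + star (-1) * b)) ^ 2
      + normSq (a - (1 - I) / 2 * (a + star I * b)) ^ 2
      + normSq (a - (1 - I) / 2 * (a + star (-I) * b)) ^ 2
      = normSq a * normSq a + normSq b * normSq b + 4 * (normSq a * normSq b) := by
  have h (ω : ℂ) : a - (1 - I) / 2 * (a + star ω * b)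
      = ⟨1 / 2, 1 / 2⟩ * a - ⟨1 / 2, -1 / 2⟩ * (star ω * b) := by
    apply Complex.ext <;> simp <;> ring
  simp only [h, normSq_apply]
  simp
  ring

theorem integral_normSq_eq_sum (i j : n) :
    ∫ U : unitaryGroup n ℂ, normSq ((U : Matrix n n ℂ) i j) ∂μ
      = ∑ k, ∫ U : unitaryGroup n ℂ,
          normSq ((U : Matrix n n ℂ) i j) * normSq ((U : Matrix n n ℂ) k j) ∂μ := by
  rw [← integral_finsetSum _ fun k _ => integrable_normSq_entry_mul μ i k j j]
  simp only [← Finset.mul_sum, sum_normSq_col, mul_one]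

theorem integrable_sum_mul_normSq_sq (d : n → ℝ) (j : n) :
    Integrable (fun U : unitaryGroup n ℂ =>
      (∑ i, d i * normSq ((U : Matrix n n ℂ) i j)) ^ 2) μ := by
  simp only [sum_mul_normSq_sq]
  exact integrable_finsetSum _ fun i _ => integrable_finsetSum _ fun k _ =>
    (integrable_normSq_entry_mul μ i k j j).const_mul _

variable [μ.IsMulLeftInvariant]

theorem four_mul_integral_normSq_sq {i k : n} (hik : i ≠ k) (j : n) :
    4 * ∫ U : unitaryGroup n ℂ, normSq ((U : Matrix n n ℂ) i j) * normSq ((U : Matrix n n ℂ) i j) ∂μ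
      = (∫ U : unitaryGroup n ℂ,
          normSq ((U : Matrix n n ℂ) i j) * normSq ((U : Matrix n n ℂ) i j) ∂μ)
        + (∫ U : unitaryGroup n ℂ,
          normSq ((U : Matrix n n ℂ) k j) * normSq ((U : Matrix n n ℂ) k j) ∂μ)
        + 4 * ∫ U : unitaryGroup n ℂ,
          normSq ((U : Matrix n n ℂ) i j) * normSq ((U : Matrix n n ℂ) k j) ∂μ := by
  have key (ω : ℂ) (hω : star ω * ω = 1) :
      Integrable (fun U : unitaryGroup n ℂ => normSq ((U : Matrix n n ℂ) i j
        - (1 - I) / 2 * ((U : Matrix n n ℂ) i j + star ω * (U : Matrix n n ℂ) k j)) ^ 2) μ ∧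
      ∫ U : unitaryGroup n ℂ, normSq ((U : Matrix n n ℂ) i j
        - (1 - I) / 2 * ((U : Matrix n n ℂ) i j + star ω * (U : Matrix n n ℂ) k j)) ^ 2 ∂μ
      = ∫ U : unitaryGroup n ℂ,
          normSq ((U : Matrix n n ℂ) i j) * normSq ((U : Matrix n n ℂ) i j) ∂μ := by
    set V : unitaryGroup n ℂ := ⟨planePhase i k ω, planePhase_mem_unitaryGroup hik hω⟩ with hV
    have hVU (U : unitaryGroup n ℂ) : normSq ((U : Matrix n n ℂ) i j
        - (1 - I) / 2 * ((U : Matrix n n ℂ) i j + star ω * (U : Matrix n n ℂ) k j)) ^ 2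
        = normSq (((V * U : unitaryGroup n ℂ) : Matrix n n ℂ) i j)
          * normSq (((V * U : unitaryGroup n ℂ) : Matrix n n ℂ) i j) := by
      rw [UnitaryGroup.mul_val, hV, planePhase_mul_apply hik, sq]
    simp only [hVU]
    exact ⟨(integrable_normSq_entry_mul μ i i j j).comp_mul_left V,
      integral_mul_left_eq_self (μ := μ) (fun U : unitaryGroup n ℂ =>
        normSq ((U : Matrix n n ℂ) i j) * normSq ((U : Matrix n n ℂ) i j)) V⟩
  obtain ⟨i1, e1⟩ := key 1 (by simp)
  obtain ⟨i2, e2⟩ := key (-1) (by simp)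
  obtain ⟨i3, e3⟩ := key I (by simp)
  obtain ⟨i4, e4⟩ := key (-I) (by simp)
  have h := integral_congr_ae (μ := μ) (Filter.Eventually.of_forall fun U : unitaryGroup n ℂ =>
    normSq_phase_average ((U : Matrix n n ℂ) i j) ((U : Matrix n n ℂ) k j))
  have q1 := integrable_normSq_entry_mul μ i i j j
  have q2 := integrable_normSq_entry_mul μ k k j j
  have q3 := integrable_normSq_entry_mul μ i k j j
  rw [integral_add ((i1.fun_add i2).fun_add i3) i4, integral_add (i1.fun_add i2) i3,
    integral_add i1 i2,
    e1, e2, e3, e4, integral_add (q1.fun_add q2) (q3.const_mul 4), integral_add q1 q2,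
    integral_const_mul] at h
  linarith

theorem integral_normSq_sq_eq (i k j : n) :
    ∫ U : unitaryGroup n ℂ, normSq ((U : Matrix n n ℂ) i j) * normSq ((U : Matrix n n ℂ) i j) ∂μ
      = ∫ U : unitaryGroup n ℂ,
          normSq ((U : Matrix n n ℂ) k j) * normSq ((U : Matrix n n ℂ) k j) ∂μ := by
  rcases eq_or_ne i k with rfl | hik
  · rfl
  have h1 := four_mul_integral_normSq_sq μ hik j
  have h2 := four_mul_integral_normSq_sq μ hik.symm j
  simp only [mul_comm (normSq (_ : ℂ)) (normSq ((_ : Matrix n n ℂ) i j))] at h1 h2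
  linarith

theorem integral_normSq_mul_of_ne {i k : n} (hik : i ≠ k) (j : n) :
    ∫ U : unitaryGroup n ℂ, normSq ((U : Matrix n n ℂ) i j) * normSq ((U : Matrix n n ℂ) k j) ∂μ
      = (∫ U : unitaryGroup n ℂ,
          normSq ((U : Matrix n n ℂ) i j) * normSq ((U : Matrix n n ℂ) i j) ∂μ) / 2 := by
  have h1 := four_mul_integral_normSq_sq μ hik j
  have h2 := integral_normSq_sq_eq μ i k j
  linarith

theorem integral_normSq_eq (i j : n) :
    ∫ U : unitaryGroup n ℂ, normSq ((U : Matrix n n ℂ) i j) ∂μ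
      = (∫ U : unitaryGroup n ℂ,
          normSq ((U : Matrix n n ℂ) i j) * normSq ((U : Matrix n n ℂ) i j) ∂μ)
        * ((Fintype.card n + 1) / 2) := by
  rw [integral_normSq_eq_sum, ← Finset.add_sum_erase _ _ (Finset.mem_univ i),
    Finset.sum_congr rfl fun k hk =>
      integral_normSq_mul_of_ne μ (Finset.ne_of_mem_erase hk).symm j,
    Finset.sum_const, Finset.card_erase_of_mem (Finset.mem_univ i), Finset.card_univ, nsmul_eq_mul,
    Nat.cast_pred (Fintype.card_pos_iff.2 ⟨i⟩)]
  ring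

/-- The fourth absolute moment of an entry of a Haar-random unitary. -/
theorem integral_normSq_sq (i j : n) :
    ∫ U : unitaryGroup n ℂ, normSq ((U : Matrix n n ℂ) i j) * normSq ((U : Matrix n n ℂ) i j) ∂μ
      = 2 / (Fintype.card n * (Fintype.card n + 1)) := by
  have h : ∑ k, ∫ U : unitaryGroup n ℂ, normSq ((U : Matrix n n ℂ) k j) ∂μ = 1 := by
    rw [← integral_finsetSum _ fun k _ => integrable_normSq_entry μ k j]
    simp [sum_normSq_col]
  simp only [integral_normSq_eq μ _ j, fun k => integral_normSq_sq_eq μ k i j, Finset.sum_const,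
    Finset.card_univ, nsmul_eq_mul] at h
  have hn : (0 : ℝ) < Fintype.card n := Nat.cast_pos.2 (Fintype.card_pos_iff.2 ⟨i⟩)
  rw [eq_div_iff (by positivity)]
  linarith

/-- The second absolute moment of an entry of a Haar-random unitary. -/
theorem integral_normSq (i j : n) :
    ∫ U : unitaryGroup n ℂ, normSq ((U : Matrix n n ℂ) i j) ∂μ = 1 / Fintype.card n := by
  have hn : (0 : ℝ) < Fintype.card n := Nat.cast_pos.2 (Fintype.card_pos_iff.2 ⟨i⟩)
  rw [integral_normSq_eq, integral_normSq_sq]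
  field_simp

theorem integral_normSq_mul (i k j : n) :
    ∫ U : unitaryGroup n ℂ, normSq ((U : Matrix n n ℂ) i j) * normSq ((U : Matrix n n ℂ) k j) ∂μ
      = (1 + if i = k then 1 else 0) / (Fintype.card n * (Fintype.card n + 1)) := by
  split_ifs with h
  · rw [← h, integral_normSq_sq]; norm_num
  · rw [integral_normSq_mul_of_ne μ h, integral_normSq_sq]; ring

theorem integral_sum_mul_normSq (d : n → ℝ) (j : n) :
    ∫ U : unitaryGroup n ℂ, ∑ i, d i * normSq ((U : Matrix n n ℂ) i j) ∂μ
      = (∑ i, d i) / Fintype.card n := by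
  rw [integral_finsetSum _ fun i _ => (integrable_normSq_entry μ i j).const_mul (d i)]
  simp only [integral_const_mul, integral_normSq, Finset.sum_div, mul_one_div]

theorem integral_sum_mul_normSq_sq (d : n → ℝ) (j : n) :
    ∫ U : unitaryGroup n ℂ, (∑ i, d i * normSq ((U : Matrix n n ℂ) i j)) ^ 2 ∂μ
      = ((∑ i, d i) ^ 2 + ∑ i, d i ^ 2) / (Fintype.card n * (Fintype.card n + 1)) := by
  simp only [sum_mul_normSq_sq]
  rw [integral_finsetSum _ fun i _ => integrable_finsetSum _ fun k _ =>
    (integrable_normSq_entry_mul μ i k j j).const_mul _]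
  have h (i : n) := integral_finsetSum Finset.univ fun k _ =>
    (integrable_normSq_entry_mul μ i k j j).const_mul (d i * d k)
  simp only [h, integral_const_mul, integral_normSq_mul, ← mul_div_assoc, ← Finset.sum_div]
  congr 1
  simp [mul_add, Finset.sum_add_distrib, sq, Finset.sum_mul_sum]

theorem trace_conj_diagonal_mul (d p : n → ℝ) (X : Matrix n n ℂ) :
    (trace (diagonal (fun i => (d i : ℂ)) * X * diagonal (fun j => (p j : ℂ)) * Xᴴ)).re
      = ∑ j, p j * ∑ i, d i * normSq (X i j) := by
  have h (i j : n) : (d i : ℂ) * X i j * p j * star (X i j)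
      = ((p j * (d i * normSq (X i j)) : ℝ) : ℂ) := by
    push_cast
    rw [normSq_eq_conj_mul_self, ← starRingEnd_apply]
    ring
  simp only [trace, diag_apply, Matrix.mul_apply (N := Xᴴ), mul_diagonal, diagonal_mul,
    conjTranspose_apply, h, ← ofReal_sum, ofReal_re, Finset.mul_sum]
  exact Finset.sum_comm

theorem trace_mul_conj_eq_sum_eigenvalues {A B : Matrix n n ℂ} (hA : A.IsHermitian)
    (hB : B.IsHermitian) (U : unitaryGroup n ℂ) :
    (trace (A * (U : Matrix n n ℂ) * B * (U : Matrix n n ℂ)ᴴ)).re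
      = ∑ j, hB.eigenvalues j * ∑ i, hA.eigenvalues i *
          normSq (((star hA.eigenvectorUnitary * (U * hB.eigenvectorUnitary) :
            unitaryGroup n ℂ) : Matrix n n ℂ) i j) := by
  have spec {C : Matrix n n ℂ} (hC : C.IsHermitian) :
      C = (hC.eigenvectorUnitary : Matrix n n ℂ) * diagonal (fun i => (hC.eigenvalues i : ℂ))
        * star (hC.eigenvectorUnitary : Matrix n n ℂ) := by
    conv_lhs => rw [hC.spectral_theorem, Unitary.conjStarAlgAut_apply]
    rfl
  rw [← trace_conj_diagonal_mul, UnitaryGroup.mul_val, UnitaryGroup.mul_val, Unitary.coe_star]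
  conv_lhs => rw [spec hA, spec hB]
  generalize diagonal (fun i => (hA.eigenvalues i : ℂ)) = D
  generalize diagonal (fun i => (hB.eigenvalues i : ℂ)) = P
  simp only [← star_eq_conjTranspose, star_mul, star_star, mul_assoc]
  rw [trace_mul_comm]
  simp only [mul_assoc]

theorem abs_eigenvalues_le_norm {A : Matrix n n ℂ} (hA : A.IsHermitian) (i : n) :
    |hA.eigenvalues i| ≤ ‖toEuclideanCLM (𝕜 := ℂ) A‖ := by
  have h : toEuclideanCLM (𝕜 := ℂ) A (hA.eigenvectorBasis i)
      = hA.eigenvalues i • hA.eigenvectorBasis i := by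
    apply WithLp.ofLp_injective
    rw [ofLp_toEuclideanCLM, hA.mulVec_eigenvectorBasis]
    rfl
  have hle := (toEuclideanCLM (𝕜 := ℂ) A).le_opNorm (hA.eigenvectorBasis i)
  rwa [h, norm_smul, hA.eigenvectorBasis.norm_eq_one, mul_one, mul_one, Real.norm_eq_abs] at hle

/-- The mean of a bilinear form in the squared moduli of the entries of a Haar-random unitary. -/
theorem integral_sum_sum_normSq (d p : n → ℝ) (hp : ∑ j, p j = 1) :
    ∫ U : unitaryGroup n ℂ, ∑ j, p j * ∑ i, d i * normSq ((U : Matrix n n ℂ) i j) ∂μ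
      = (∑ i, d i) / Fintype.card n := by
  rw [integral_finsetSum _ fun j _ => (integrable_finsetSum _ fun i _ =>
    (integrable_normSq_entry μ i j).const_mul (d i)).const_mul (p j)]
  simp only [integral_const_mul, integral_sum_mul_normSq, ← Finset.sum_mul, hp, one_mul]

theorem integral_sum_sum_normSq_sq_le (d p : n → ℝ) (hp0 : ∀ j, 0 ≤ p j) (hp : ∑ j, p j = 1) :
    ∫ U : unitaryGroup n ℂ, (∑ j, p j * ∑ i, d i * normSq ((U : Matrix n n ℂ) i j)) ^ 2 ∂μ
      ≤ ((∑ i, d i) ^ 2 + ∑ i, d i ^ 2) / (Fintype.card n * (Fintype.card n + 1)) := by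
  have hi (j : n) := (integrable_sum_mul_normSq_sq μ d j).const_mul (p j)
  calc
    _ ≤ ∫ U : unitaryGroup n ℂ, ∑ j, p j * (∑ i, d i * normSq ((U : Matrix n n ℂ) i j)) ^ 2 ∂μ := by
      refine integral_mono_of_nonneg (Filter.Eventually.of_forall fun U => sq_nonneg _)
        (integrable_finsetSum _ fun j _ => hi j) (Filter.Eventually.of_forall fun U => ?_)
      exact Real.pow_arith_mean_le_arith_mean_pow_of_even Finset.univ p _ (fun j _ => hp0 j) hp
        even_two
    _ = _ := by
      rw [integral_finsetSum _ fun j _ => hi j]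
      simp only [integral_const_mul, integral_sum_mul_normSq_sq, ← Finset.sum_mul, hp, one_mul]

end Haar

/-- For `N ≥ 2`, a density matrix `ρ` on `ℂ^N` and a Hermitian `O ∈ M_N(ℂ)`
with operator norm `‖O‖_∞ ≤ 1`, the variance of the (real) expectation value `tr(O U ρ U†)`
over a Haar-random unitary `U` is at most `1/(N+1)`. -/
theorem variance_expectation_value_haar (N : ℕ) (hN : 2 ≤ N)
    (ρ O : Matrix (Fin N) (Fin N) ℂ)
    (hρ : ρ.PosSemidef) (hρtr : ρ.trace = 1) (hO : O.IsHermitian)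
    (hOnorm : ‖Matrix.toEuclideanCLM (𝕜 := ℂ) O‖ ≤ 1)
    (μH : Measure (Matrix.unitaryGroup (Fin N) ℂ))
    [IsProbabilityMeasure μH] [μH.IsMulLeftInvariant] [μH.IsMulRightInvariant] :
    (∫ U : Matrix.unitaryGroup (Fin N) ℂ,
        ((Matrix.trace (O * (U : Matrix (Fin N) (Fin N) ℂ) * ρ *
          (U : Matrix (Fin N) (Fin N) ℂ)ᴴ)).re) ^ 2 ∂μH)
      - (∫ U : Matrix.unitaryGroup (Fin N) ℂ,
          (Matrix.trace (O * (U : Matrix (Fin N) (Fin N) ℂ) * ρ *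
            (U : Matrix (Fin N) (Fin N) ℂ)ᴴ)).re ∂μH) ^ 2
      ≤ 1 / ((N : ℝ) + 1) := by
  have hN0 : (0 : ℝ) < N := by exact_mod_cast (by omega : 0 < N)
  set d := hO.eigenvalues
  set p := hρ.1.eigenvalues
  have hp1 : ∑ j, p j = 1 := by
    have h := hρ.1.trace_eq_sum_eigenvalues
    rw [hρtr] at h
    apply Complex.ofReal_injective
    rw [Complex.ofReal_sum]
    exact h.symm
  have hd2 : ∑ i, d i ^ 2 ≤ N := by
    refine (Finset.sum_le_card_nsmul Finset.univ _ 1 fun i _ => ?_).trans (by simp)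
    exact (sq_le_one_iff_abs_le_one _).2 ((abs_eigenvalues_le_norm hO i).trans hOnorm)
  have hinv (g : Matrix.unitaryGroup (Fin N) ℂ → ℝ) :
      ∫ U, g (star hO.eigenvectorUnitary * (U * hρ.1.eigenvectorUnitary)) ∂μH = ∫ U, g U ∂μH := by
    rw [integral_mul_right_eq_self (μ := μH) (fun U => g (star hO.eigenvectorUnitary * U)),
      integral_mul_left_eq_self]
  simp only [trace_mul_conj_eq_sum_eigenvalues hO hρ.1]
  rw [hinv fun U => (∑ j, p j * ∑ i, d i *
      Complex.normSq ((U : Matrix (Fin N) (Fin N) ℂ) i j)) ^ 2,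
    hinv fun U => ∑ j, p j * ∑ i, d i * Complex.normSq ((U : Matrix (Fin N) (Fin N) ℂ) i j),
    integral_sum_sum_normSq μH d p hp1]
  have h := integral_sum_sum_normSq_sq_le μH d p hρ.eigenvalues_nonneg hp1
  rw [Fintype.card_fin] at h ⊢
  refine (sub_le_sub_right h _).trans ?_
  set S := ∑ i, d i
  have hS : S ^ 2 / (N * (N + 1)) ≤ (S / N) ^ 2 := by
    rw [div_pow]
    exact div_le_div_of_nonneg_left (sq_nonneg S) (by positivity) (by nlinarith)
  have hD : (∑ i, d i ^ 2) / (N * (N + 1)) ≤ 1 / ((N : ℝ) + 1) := by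
    rw [div_le_div_iff₀ (by positivity) (by positivity)]
    nlinarith
  rw [add_div]
  linarith

end
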